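/- Let ρ be an arbitrary state in 𝔖(ℋ). Then S(σ) ≥ S̃([ρ−εI]₊) − h↑(ε) for any state σ ∈ 𝔖(ℋ) such that ½‖ρ−σ‖₁ ≤ ε ∈ (0,1]. Moreover, this local lower bound is faithful: S̃([ρ−εI]₊) − h↑(ε) → S(ρ) ≤ +∞ as ε → 0. -/

import Mathlib

open scoped ENNReal InnerProductSpace
open MeasureTheory

noncomputable section

namespace AFW

attribute [local instance] Classical.propDecidable

variable {𝓗 : Type*} [NormedAddCommGroup 𝓗] [InnerProductSpace ℂ 𝓗] [CompleteSpace 𝓗]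

/-- Trace-type functional: on positive operators it is the trace; on self-adjoint
trace-class operators it is the trace norm `‖·‖₁`. -/
def trNorm (T : 𝓗 →L[ℂ] 𝓗) : ℝ≥0∞ :=
  ⨆ (s : Set 𝓗) (_ : Orthonormal ℂ (Subtype.val : s → 𝓗)),
    ∑' x : s, (‖⟪(x : 𝓗), T x⟫_ℂ‖₊ : ℝ≥0∞)

/-- `ρ` is a quantum state: a positive (trace-class) operator with unit trace. -/
def IsState (ρ : 𝓗 →L[ℂ] 𝓗) : Prop := ρ.IsPositive ∧ trNorm ρ = 1

/-- `ρ ∧ εI` (spectral cut-off from above). -/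
def cut (ρ : 𝓗 →L[ℂ] 𝓗) (ε : ℝ) : 𝓗 →L[ℂ] 𝓗 := cfc (fun x : ℝ => min x ε) ρ

/-- `[ρ − εI]₊`. -/
def cutAbove (ρ : 𝓗 →L[ℂ] 𝓗) (ε : ℝ) : 𝓗 →L[ℂ] 𝓗 := cfc (fun x : ℝ => max (x - ε) 0) ρ

/-- positive part `[T]₊` of a self-adjoint operator. -/
def posP (T : 𝓗 →L[ℂ] 𝓗) : 𝓗 →L[ℂ] 𝓗 := cfc (fun x : ℝ => max x 0) T

/-- negative part `[T]₋` of a self-adjoint operator. -/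
def negP (T : 𝓗 →L[ℂ] 𝓗) : 𝓗 →L[ℂ] 𝓗 := cfc (fun x : ℝ => max (-x) 0) T

def sqrtOp (T : 𝓗 →L[ℂ] 𝓗) : 𝓗 →L[ℂ] 𝓗 := cfc Real.sqrt T

def eta (x : ℝ) : ℝ := -(x * Real.log x)

/-- The von Neumann entropy `S(ρ) = Tr η(ρ)`, with values in `[0,+∞]`. -/
def entropy (ρ : 𝓗 →L[ℂ] 𝓗) : ℝ≥0∞ := trNorm (cfc eta ρ)

/-- Homogeneous extension `S̃` of the von Neumann entropy to the positive cone. -/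
def entExt (ρ : 𝓗 →L[ℂ] 𝓗) : ℝ≥0∞ :=
  if ρ = 0 then 0 else trNorm ρ * entropy ((trNorm ρ).toReal⁻¹ • ρ)

def binEnt (p : ℝ) : ℝ := eta p + eta (1 - p)

def binEntUp (x : ℝ) : ℝ := if x ≤ 1 / 2 then binEnt x else Real.log 2

def etaUp (x : ℝ) : ℝ := if x ≤ (Real.exp 1)⁻¹ then eta x else (Real.exp 1)⁻¹

/-- nondecreasing modification `a↑` used for control functions. -/
def up (a : ℝ → ℝ) (x : ℝ) : ℝ := if x ≤ 1 / 2 then a x else a (1 / 2)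

/-- Control functions for LAA functions. -/
structure ControlPair (a b : ℝ → ℝ) : Prop where
  conta : ContinuousOn a (Set.Icc 0 1)
  contb : ContinuousOn b (Set.Icc 0 1)
  zeroa : a 0 = 0
  zerob : b 0 = 0
  cva : ConcaveOn ℝ (Set.Icc 0 (1 / 2)) a
  cvb : ConcaveOn ℝ (Set.Icc 0 (1 / 2)) b
  mona : MonotoneOn a (Set.Icc 0 (1 / 2))
  monb : MonotoneOn b (Set.Icc 0 (1 / 2))

/-- `f` is locally almost affine on `S0` with control functions `a`, `b`. -/
def IsLAA (S0 : Set (𝓗 →L[ℂ] 𝓗)) (f : (𝓗 →L[ℂ] 𝓗) → EReal) (a b : ℝ → ℝ) : Prop :=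
  ∀ ρ ∈ S0, ∀ σ ∈ S0, ∀ p : ℝ, 0 ≤ p → p ≤ 1 →
    ((p : EReal) * f ρ + ((1 - p : ℝ) : EReal) * f σ) - ((a p : ℝ) : EReal)
        ≤ f (p • ρ + (1 - p) • σ) ∧
      f (p • ρ + (1 - p) • σ)
        ≤ ((p : EReal) * f ρ + ((1 - p : ℝ) : EReal) * f σ) + ((b p : ℝ) : EReal)

/-- Homogeneous extension of `f` to the cone generated by its domain. -/
def homExt (f : (𝓗 →L[ℂ] 𝓗) → EReal) (T : 𝓗 →L[ℂ] 𝓗) : EReal :=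
  if T = 0 then 0 else (trNorm T : EReal) * f ((trNorm T).toReal⁻¹ • T)

/-- The barycenter `Ω(μ)` of the family `w` with respect to `μ`. -/
def Omega {X : Type*} [MeasurableSpace X] (w : X → 𝓗 →L[ℂ] 𝓗) (μ : Measure X) :
    𝓗 →L[ℂ] 𝓗 := ∫ x, w x ∂μ

/-- The quasi-classical set of states generated by `(X, 𝔉, w)`. -/
def QSet {X : Type*} [MeasurableSpace X] (w : X → 𝓗 →L[ℂ] 𝓗) : Set (𝓗 →L[ℂ] 𝓗) :=
  {ρ | ∃ μ : Measure X, IsProbabilityMeasure μ ∧ ρ = Omega w μ}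

/-- Total variation distance between measures. -/
def TV {X : Type*} [MeasurableSpace X] (μ ν : Measure X) : ℝ≥0∞ :=
  ⨆ (A : Set X) (_ : MeasurableSet A), (μ A - ν A) ⊔ (ν A - μ A)

/-- `Tr H ρ` for a positive operator `H = Σ h_k |τ_k⟩⟨τ_k|` given by discrete spectral data. -/
def energy (h : ℕ → ℝ) (τ : ℕ → 𝓗) (ρ : 𝓗 →L[ℂ] 𝓗) : ℝ≥0∞ :=
  if LinearMap.range (ρ : 𝓗 →ₗ[ℂ] 𝓗) ≤ (Submodule.span ℂ (Set.range τ)).topologicalClosure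
  then ∑' k, ENNReal.ofReal (h k * (⟪τ k, ρ (τ k)⟫_ℂ).re)
  else ⊤

/-- A positive operator with discrete spectral representation `Σ h_k |τ_k⟩⟨τ_k|`
(nondecreasing nonnegative eigenvalue sequence, orthonormal eigenvectors). -/
structure DiscreteOp (h : ℕ → ℝ) (τ : ℕ → 𝓗) : Prop where
  ortho : Orthonormal ℂ τ
  nonneg : ∀ k, 0 ≤ h k
  mono : Monotone h

/-- The Gibbs condition `Tr e^{−βH} < ∞` for all `β > 0`. -/
def GibbsCondition (h : ℕ → ℝ) : Prop := ∀ β : ℝ, 0 < β → Summable fun k => Real.exp (-β * h k)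

/-- `F_H(E) = sup { S(ρ) : Tr Hρ ≤ E }`. -/
def FH (h : ℕ → ℝ) (τ : ℕ → 𝓗) (E : ℝ≥0∞) : ℝ≥0∞ :=
  ⨆ (ϑ : 𝓗 →L[ℂ] 𝓗) (_ : IsState ϑ) (_ : energy h τ ϑ ≤ E), entropy ϑ

/-- `Tr(ρ M)` for positive `ρ`, `M`, computed as `Tr(√ρ M √ρ)`. -/
def trPair (ρ M : 𝓗 →L[ℂ] 𝓗) : ℝ≥0∞ := trNorm (sqrtOp ρ * M * sqrtOp ρ)

/-- classical relative entropy of two finite tuples. -/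
def klFin {n : ℕ} (p q : Fin n → ℝ) : ℝ≥0∞ :=
  if ∀ i, q i = 0 → p i = 0 then
    ENNReal.ofReal (∑ i, if p i = 0 then 0 else p i * Real.log (p i / q i))
  else ⊤

/-- The quantum relative entropy `D(ρ‖σ)`, realized as the supremum of classical
relative entropies of outcome distributions over all finite quantum measurements. -/
def relEnt (ρ σ : 𝓗 →L[ℂ] 𝓗) : ℝ≥0∞ :=
  ⨆ (n : ℕ) (M : Fin n → 𝓗 →L[ℂ] 𝓗) (_ : ∀ i, (M i).IsPositive) (_ : ∑ i, M i = 1),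
    klFin (fun i => (trPair ρ (M i)).toReal) (fun i => (trPair σ (M i)).toReal)

/-- rank of an operator (junk value `0` if infinite). -/
def opRank (T : 𝓗 →L[ℂ] 𝓗) : ℕ := Module.finrank ℂ (LinearMap.range (T : 𝓗 →ₗ[ℂ] 𝓗))

/-- a positive trace-preserving linear map (such as a partial trace). -/
def IsMarginal {𝓚 : Type*} [NormedAddCommGroup 𝓚] [InnerProductSpace ℂ 𝓚] [CompleteSpace 𝓚]
    (Λ : (𝓗 →L[ℂ] 𝓗) →ₗ[ℂ] (𝓚 →L[ℂ] 𝓚)) : Prop :=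
  (∀ T : 𝓗 →L[ℂ] 𝓗, T.IsPositive → (Λ T).IsPositive) ∧
  (∀ T : 𝓗 →L[ℂ] 𝓗, T.IsPositive → trNorm (Λ T) = trNorm T)

end AFW

namespace AFW

universe u

variable {ι : Type*} {𝓗 : Type u} [NormedAddCommGroup 𝓗] [InnerProductSpace ℂ 𝓗]

theorem hasSum_norm_sq_inner (b : HilbertBasis ι ℂ 𝓗) (x : 𝓗) :
    HasSum (fun i => ‖⟪b i, x⟫_ℂ‖ ^ 2) (‖x‖ ^ 2) := by
  have h := (b.hasSum_inner_mul_inner x x).mapL Complex.reCLM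
  convert h using 1
  · ext i
    rw [← inner_conj_symm x (b i), RCLike.conj_mul, Complex.reCLM_apply]
    norm_cast
  · rw [Complex.reCLM_apply]
    exact (inner_self_eq_norm_sq (𝕜 := ℂ) x).symm

theorem trNorm_zero : trNorm (0 : 𝓗 →L[ℂ] 𝓗) = 0 := by
  simp [trNorm]

theorem tsum_enorm_inner_le_trNorm {s : Set 𝓗} (T : 𝓗 →L[ℂ] 𝓗)
    (hs : Orthonormal ℂ (Subtype.val : s → 𝓗)) :
    ∑' x : s, (‖⟪(x : 𝓗), T x⟫_ℂ‖₊ : ℝ≥0∞) ≤ trNorm T :=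
  le_iSup₂_of_le s hs le_rfl

theorem tsum_enorm_inner_range {v : ι → 𝓗} (hv : Orthonormal ℂ v) (T : 𝓗 →L[ℂ] 𝓗) :
    ∑' x : Set.range v, (‖⟪(x : 𝓗), T x⟫_ℂ‖₊ : ℝ≥0∞) = ∑' i, (‖⟪v i, T (v i)⟫_ℂ‖₊ : ℝ≥0∞) :=
  tsum_range (fun x => (‖⟪x, T x⟫_ℂ‖₊ : ℝ≥0∞)) hv.linearIndependent.injective

theorem tsum_enorm_inner_orthonormal_le_trNorm {v : ι → 𝓗} (hv : Orthonormal ℂ v)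
    (T : 𝓗 →L[ℂ] 𝓗) : ∑' i, (‖⟪v i, T (v i)⟫_ℂ‖₊ : ℝ≥0∞) ≤ trNorm T := by
  rw [← tsum_enorm_inner_range hv]
  exact tsum_enorm_inner_le_trNorm T hv.toSubtypeRange

variable [CompleteSpace 𝓗]

open Classical in
/-- A positive operator with finite trace is compact. -/
theorem isCompactOperator_of_trNorm_ne_top {T : 𝓗 →L[ℂ] 𝓗} (hT : T.IsPositive)
    (htr : trNorm T ≠ ⊤) : IsCompactOperator T := by
  have hT0 : 0 ≤ T := (ContinuousLinearMap.nonneg_iff_isPositive T).2 hT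
  set S := CFC.sqrt T with hS
  have hSS : S * S = T := CFC.sqrt_mul_sqrt_self T
  have hSpos : S.IsPositive :=
    (ContinuousLinearMap.nonneg_iff_isPositive S).1 (CFC.sqrt_nonneg T)
  have hsym (x y : 𝓗) : ⟪S x, y⟫_ℂ = ⟪x, S y⟫_ℂ := hSpos.isSymmetric x y
  suffices h : IsCompactOperator S by
    rw [← hSS]
    exact h.comp_clm S
  obtain ⟨w, b, -⟩ := exists_hilbertBasis ℂ 𝓗
  have hnorm (i : w) : ‖⟪b i, T (b i)⟫_ℂ‖ = ‖S (b i)‖ ^ 2 := by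
    rw [← hSS, mul_apply_eq_comp, ← hsym, inner_self_eq_norm_sq_to_K]
    simp
  have hsum : Summable fun i => ‖S (b i)‖ ^ 2 := by
    have h := ne_top_of_le_ne_top htr (tsum_enorm_inner_orthonormal_le_trNorm b.orthonormal T)
    refine (NNReal.summable_coe.2 (ENNReal.tsum_coe_ne_top_iff_summable.1 h)).congr fun i => ?_
    rw [coe_nnnorm, hnorm]
  let A : Finset w → 𝓗 →L[ℂ] 𝓗 := fun F => ∑ i ∈ F, (innerSL ℂ (S (b i))).smulRight (b i)
  have hA (F : Finset w) : IsCompactOperator (A F) := by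
    refine (compactOperator (RingHom.id ℂ) 𝓗 𝓗).sum_mem fun i _ => ?_
    exact (isCompactOperator_of_locallyCompactSpace_rng
      (ContinuousLinearMap.toSpanSingleton ℂ (b i))).comp_clm (innerSL ℂ (S (b i)))
  refine isCompactOperator_of_tendsto (l := Filter.atTop) (F := A) ?_
    (Filter.Eventually.of_forall hA)
  have hbound (F : Finset w) :
      ‖A F - S‖ ≤ √(∑' i : {i // i ∉ F}, ‖S (b i)‖ ^ 2) := by
    refine ContinuousLinearMap.opNorm_le_bound _ (Real.sqrt_nonneg _) fun x => ?_
    rw [← Real.sqrt_sq (norm_nonneg x), ← Real.sqrt_mul (tsum_nonneg fun i => sq_nonneg _)]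
    refine Real.le_sqrt_of_sq_le ?_
    have hcoef (i : w) : ⟪b i, (A F - S) x⟫_ℂ = if i ∈ F then 0 else -⟪S (b i), x⟫_ℂ := by
      have hAx : ⟪b i, A F x⟫_ℂ = if i ∈ F then ⟪S (b i), x⟫_ℂ else 0 := by
        simp only [A, _root_.sum_apply, ContinuousLinearMap.smulRight_apply,
          innerSL_apply_apply, inner_sum, inner_smul_right,
          orthonormal_iff_ite.1 b.orthonormal]
        simp
      rw [_root_.sub_apply, inner_sub_right, hAx, ← hsym]
      split_ifs <;> simp
    have hpars := hasSum_norm_sq_inner b ((A F - S) x)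
    have hle : ∀ i, ‖⟪b i, (A F - S) x⟫_ℂ‖ ^ 2 ≤
        Set.indicator {i | i ∉ F} (fun i => ‖S (b i)‖ ^ 2 * ‖x‖ ^ 2) i := by
      intro i
      rw [hcoef]
      by_cases hi : i ∈ F
      · simp [hi]
      · simp only [hi, if_false, norm_neg, Set.indicator, Set.mem_ofPred_eq, not_false_eq_true,
          if_true, ← mul_pow]
        gcongr
        exact norm_inner_le_norm _ _
    have hsum' := (hsum.mul_right (‖x‖ ^ 2)).indicator {i | i ∉ F}
    refine (hasSum_le hle hpars hsum'.hasSum).trans_eq ?_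
    rw [← tsum_mul_right]
    exact (tsum_subtype {i | i ∉ F} fun i => ‖S (b i)‖ ^ 2 * ‖x‖ ^ 2).symm
  rw [tendsto_iff_norm_sub_tendsto_zero]
  refine squeeze_zero (fun _ => norm_nonneg _) hbound ?_
  have := (tendsto_tsum_compl_atTop_zero fun i => ‖S (b i)‖ ^ 2).sqrt
  simpa using this

open scoped ComplexOrder in
/-- A positive operator with finite trace has an orthonormal eigenbasis. -/
theorem exists_eigenbasis {T : 𝓗 →L[ℂ] 𝓗} (hT : T.IsPositive) (htr : trNorm T ≠ ⊤) :
    ∃ (κ : Type u) (b : HilbertBasis κ ℂ 𝓗) (c : κ → ℝ),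
      ∀ i, 0 ≤ c i ∧ T (b i) = (c i : ℂ) • b i := by
  have hcomp := isCompactOperator_of_trNorm_ne_top hT htr
  have hsymm : (T : 𝓗 →ₗ[ℂ] 𝓗).IsSymmetric := hT.isSymmetric
  let E : ℂ → Submodule ℂ 𝓗 := fun μ => Module.End.eigenspace (T : 𝓗 →ₗ[ℂ] 𝓗) μ
  have hmemE (μ : ℂ) (x : 𝓗) : x ∈ E μ ↔ T x = μ • x := Module.End.mem_eigenspace_iff
  have hclosed (μ : ℂ) : IsClosed (E μ : Set 𝓗) := by
    have : (E μ : Set 𝓗) = {x | T x = μ • x} := by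
      ext x
      exact hmemE μ x
    rw [this]
    exact isClosed_eq T.continuous (continuous_const_smul μ)
  have (μ : ℂ) : CompleteSpace (E μ) := (hclosed μ).completeSpace_coe
  choose w b hb using fun μ => exists_hilbertBasis ℂ (E μ)
  have hon := hsymm.orthogonalFamily_eigenspaces.orthonormal_sigma_orthonormal
    (v_family := fun μ => b μ) fun μ => (b μ).orthonormal
  have hspan : (Submodule.span ℂ (Set.range
      fun a : Σ μ, w μ => (E a.1).subtypeₗᵢ (b a.1 a.2)))ᗮ = ⊥ := by
    rw [eq_bot_iff, ← ContinuousLinearMap.orthogonalComplement_iSup_eigenspaces_eq_bot hcomp hsymm]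
    intro x hx
    rw [Submodule.mem_orthogonal] at hx
    rw [← Submodule.iInf_orthogonal, Submodule.mem_iInf]
    intro μ
    rw [Submodule.mem_orthogonal]
    intro u hu
    have hzero : ∀ i, ⟪(b μ i : 𝓗), x⟫_ℂ = 0 := fun i =>
      hx _ (Submodule.subset_span ⟨⟨μ, i⟩, rfl⟩)
    have h1 := ((b μ).hasSum_repr ⟨u, hu⟩).mapL (E μ).subtypeL
    have h2 := h1.mapL (innerSL ℂ x)
    have h3 : ⟪x, u⟫_ℂ = 0 := by
      refine h2.unique ?_
      convert hasSum_zero using 2 with i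
      simp [inner_eq_zero_symm.1 (hzero i)]
    exact inner_eq_zero_symm.1 h3
  let B := HilbertBasis.mkOfOrthogonalEqBot hon hspan
  have hB (i : Σ μ, w μ) : B i = (b i.1 i.2 : 𝓗) := by
    simp [B, HilbertBasis.coe_mkOfOrthogonalEqBot]
  refine ⟨_, B, fun i : Σ μ, w μ => i.1.re, fun i => ?_⟩
  have hTB : T (B i) = i.1 • B i := (hmemE i.1 _).1 (by rw [hB]; exact (b i.1 i.2).2)
  have hpos : 0 ≤ ⟪B i, T (B i)⟫_ℂ := hT.inner_nonneg_right _
  rw [hTB, inner_smul_right, inner_self_eq_norm_sq_to_K, B.orthonormal.1 i] at hpos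
  simp only [RCLike.ofReal_one, one_pow, mul_one] at hpos
  refine ⟨(Complex.nonneg_iff.1 hpos).1, ?_⟩
  rw [hTB]
  congr 1
  exact Complex.ext rfl (by simpa using (Complex.nonneg_iff.1 hpos).2.symm)

/-- Functional calculus acts on eigenvectors through the eigenvalue. -/
theorem cfc_apply_eigenvector {T : 𝓗 →L[ℂ] 𝓗} (hT : IsSelfAdjoint T) {g : ℝ → ℝ}
    (hg : Continuous g) {x : 𝓗} {c : ℝ} (hx : T x = (c : ℂ) • x) :
    cfc g T x = (g c : ℂ) • x := by
  rcases eq_or_ne x 0 with rfl | hx0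
  · simp
  have hc : c ∈ spectrum ℝ T := by
    refine spectrum.of_algebraMap_mem ℂ ?_
    rw [ContinuousLinearMap.spectrum_eq]
    exact (Module.End.hasEigenvalue_of_hasEigenvector
      (Module.End.hasEigenvector_iff.2 ⟨Module.End.mem_eigenspace_iff.2 hx, hx0⟩)).mem_spectrum
  rw [cfc_apply g T hT hg.continuousOn]
  suffices h : ∀ f : C(spectrum ℝ T, ℝ), cfcHom hT f x = (f ⟨c, hc⟩ : ℂ) • x from h _
  have : CompactSpace (spectrum ℝ T) := isCompact_iff_compactSpace.1
    (ContinuousFunctionalCalculus.isCompact_spectrum T)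
  intro f
  induction f using ContinuousMap.induction_on_of_compact with
  | const r =>
    have : ContinuousMap.const (spectrum ℝ T) r = algebraMap ℝ _ r := rfl
    rw [this, AlgHomClass.commutes]
    simp [Algebra.algebraMap_eq_smul_one]
  | id => rw [cfcHom_id]; exact hx
  | star_id => rw [star_trivial, cfcHom_id]; exact hx
  | add f g hf hg => simp [map_add, hf, hg, add_smul]
  | mul f g hf hg => rw [map_mul, mul_apply_eq_comp, hg, map_smul, hf, ContinuousMap.mul_apply,
      Complex.ofReal_mul, mul_smul, smul_comm]
  | frequently f h =>
    refine h.mem_of_closed (isClosed_eq ?_ ?_)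
    · have : Continuous (cfcHom (R := ℝ) hT) := cfcHom_continuous hT
      fun_prop
    · fun_prop

theorem hasSum_inner_eigenbasis (b : HilbertBasis ι ℂ 𝓗) {T : 𝓗 →L[ℂ] 𝓗} {c : ι → ℝ}
    (hT : IsSelfAdjoint T) (hb : ∀ i, T (b i) = (c i : ℂ) • b i) (x : 𝓗) :
    HasSum (fun i => ((c i * ‖⟪b i, x⟫_ℂ‖ ^ 2 : ℝ) : ℂ)) ⟪x, T x⟫_ℂ := by
  have h := b.hasSum_inner_mul_inner x (T x)
  have hfun : (fun i => ⟪x, b i⟫_ℂ * ⟪b i, T x⟫_ℂ) =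
      fun i => ((c i * ‖⟪b i, x⟫_ℂ‖ ^ 2 : ℝ) : ℂ) := funext fun i => by
    have hsym : ⟪T (b i), x⟫_ℂ = ⟪b i, T x⟫_ℂ := hT.isSymmetric (b i) x
    rw [← hsym, hb, inner_smul_left, Complex.conj_ofReal, ← inner_conj_symm x (b i),
      mul_left_comm, RCLike.conj_mul]
    rw [Complex.ofReal_mul, Complex.ofReal_pow]
    rfl
  rwa [hfun] at h

theorem hasSum_re_inner_eigenbasis (b : HilbertBasis ι ℂ 𝓗) {T : 𝓗 →L[ℂ] 𝓗} {c : ι → ℝ}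
    (hT : IsSelfAdjoint T) (hb : ∀ i, T (b i) = (c i : ℂ) • b i) (x : 𝓗) :
    HasSum (fun i => c i * ‖⟪b i, x⟫_ℂ‖ ^ 2) (⟪x, T x⟫_ℂ).re :=
  Complex.hasSum_re (hasSum_inner_eigenbasis b hT hb x)

/-- The quadratic form of a positive diagonal operator is an `ℝ≥0∞`-valued sum. -/
theorem enorm_inner_eq_tsum (b : HilbertBasis ι ℂ 𝓗) {T : 𝓗 →L[ℂ] 𝓗} {c : ι → ℝ}
    (hc : ∀ i, 0 ≤ c i) (hT : IsSelfAdjoint T) (hb : ∀ i, T (b i) = (c i : ℂ) • b i) (x : 𝓗) :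
    (‖⟪x, T x⟫_ℂ‖₊ : ℝ≥0∞) =
      ∑' i, ENNReal.ofReal (c i) * ENNReal.ofReal (‖⟪x, b i⟫_ℂ‖ ^ 2) := by
  have h := hasSum_re_inner_eigenbasis b hT hb x
  have hnn : ∀ i, 0 ≤ c i * ‖⟪b i, x⟫_ℂ‖ ^ 2 := fun i => mul_nonneg (hc i) (sq_nonneg _)
  have hx : ⟪x, T x⟫_ℂ = ((⟪x, T x⟫_ℂ).re : ℂ) :=
    (hasSum_inner_eigenbasis b hT hb x).unique (Complex.hasSum_ofReal.2 h)
  rw [← enorm_eq_nnnorm, ← ofReal_norm, hx, Complex.norm_real, Real.norm_of_nonneg (h.nonneg hnn),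
    ← h.tsum_eq, ENNReal.ofReal_tsum_of_nonneg hnn h.summable]
  refine tsum_congr fun i => ?_
  rw [ENNReal.ofReal_mul (hc i), norm_inner_symm]

/-- The trace of a positive diagonal operator is the sum of its eigenvalues. -/
theorem trNorm_eq_tsum (b : HilbertBasis ι ℂ 𝓗) {T : 𝓗 →L[ℂ] 𝓗} {c : ι → ℝ}
    (hc : ∀ i, 0 ≤ c i) (hT : IsSelfAdjoint T) (hb : ∀ i, T (b i) = (c i : ℂ) • b i) :
    trNorm T = ∑' i, ENNReal.ofReal (c i) := by
  apply le_antisymm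
  · refine iSup₂_le fun s hs => ?_
    simp_rw [enorm_inner_eq_tsum b hc hT hb]
    rw [ENNReal.tsum_comm]
    simp_rw [ENNReal.tsum_mul_left]
    refine ENNReal.tsum_le_tsum fun i => mul_le_of_le_one_right' ?_
    rw [← ENNReal.ofReal_tsum_of_nonneg (fun _ => sq_nonneg _)
      (hs.inner_products_summable (b i)), ← ENNReal.ofReal_one]
    refine ENNReal.ofReal_le_ofReal ((hs.tsum_inner_products_le (b i)).trans_eq ?_)
    rw [b.orthonormal.1 i, one_pow]
  · refine le_of_eq_of_le (tsum_congr fun i => ?_)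
      (tsum_enorm_inner_orthonormal_le_trNorm b.orthonormal T)
    rw [hb, inner_smul_right, inner_self_eq_norm_sq_to_K, b.orthonormal.1 i, ← enorm_eq_nnnorm,
      ← ofReal_norm]
    simp [abs_of_nonneg (hc i)]

/-- The trace of a positive diagonal operator can be computed in any Hilbert basis. -/
theorem tsum_enorm_inner_hilbertBasis {κ : Type*} (b : HilbertBasis ι ℂ 𝓗) {T : 𝓗 →L[ℂ] 𝓗}
    {c : ι → ℝ} (hc : ∀ i, 0 ≤ c i) (hT : IsSelfAdjoint T)
    (hb : ∀ i, T (b i) = (c i : ℂ) • b i) (e : HilbertBasis κ ℂ 𝓗) :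
    ∑' k, (‖⟪e k, T (e k)⟫_ℂ‖₊ : ℝ≥0∞) = trNorm T := by
  rw [trNorm_eq_tsum b hc hT hb]
  simp_rw [enorm_inner_eq_tsum b hc hT hb]
  rw [ENNReal.tsum_comm]
  simp_rw [ENNReal.tsum_mul_left]
  refine tsum_congr fun i => ?_
  have h := hasSum_norm_sq_inner e (b i)
  rw [← ENNReal.ofReal_tsum_of_nonneg (fun _ => sq_nonneg _) h.summable, h.tsum_eq,
    b.orthonormal.1 i]
  simp

/-- A state has unit trace in every Hilbert basis. -/
theorem IsState.hasSum_re_inner {ρ : 𝓗 →L[ℂ] 𝓗} (hρ : IsState ρ) (e : HilbertBasis ι ℂ 𝓗) :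
    HasSum (fun k => (⟪e k, ρ (e k)⟫_ℂ).re) 1 := by
  obtain ⟨κ, b, c, hc⟩ := exists_eigenbasis hρ.1 (hρ.2 ▸ ENNReal.one_ne_top)
  have h := tsum_enorm_inner_hilbertBasis b (fun i => (hc i).1) hρ.1.isSelfAdjoint
    (fun i => (hc i).2) e
  rw [hρ.2] at h
  have hs : HasSum (fun k => ‖⟪e k, ρ (e k)⟫_ℂ‖₊) 1 := by
    rw [← ENNReal.hasSum_coe, ENNReal.coe_one, ← h]
    exact ENNReal.summable.hasSum
  have hs' := NNReal.hasSum_coe.2 hs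
  rw [NNReal.coe_one] at hs'
  convert hs' using 2 with k
  have hx := (hasSum_inner_eigenbasis b hρ.1.isSelfAdjoint (fun i => (hc i).2) (e k)).unique
    (Complex.hasSum_ofReal.2
      (hasSum_re_inner_eigenbasis b hρ.1.isSelfAdjoint (fun i => (hc i).2) (e k)))
  conv_rhs => rw [coe_nnnorm, hx, Complex.norm_real]
  exact (Real.norm_of_nonneg (hρ.1.re_inner_nonneg_right (e k))).symm

/-- Trace-norm closeness of states bounds the difference of their quadratic forms. -/
theorem re_inner_le_of_trNorm_sub_le {ρ σ : 𝓗 →L[ℂ] 𝓗} (hρ : IsState ρ) (hσ : IsState σ)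
    {ε : ℝ} (hε : 0 ≤ ε) (h : trNorm (ρ - σ) ≤ ENNReal.ofReal (2 * ε)) (x : 𝓗) :
    (⟪x, ρ x⟫_ℂ).re ≤ (⟪x, σ x⟫_ℂ).re + ε * ‖x‖ ^ 2 := by
  have unit (y : 𝓗) (hy : ‖y‖ = 1) : (⟪y, ρ y⟫_ℂ).re ≤ (⟪y, σ y⟫_ℂ).re + ε := by
    have hon : Orthonormal ℂ (Subtype.val : ({y} : Set 𝓗) → 𝓗) :=
      ⟨fun z => by rw [z.2, hy], fun z w hzw => absurd (Subsingleton.elim z w) hzw⟩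
    obtain ⟨w, e, hw, he⟩ := hon.exists_hilbertBasis_extension
    let k : w := ⟨y, hw rfl⟩
    have hk : e k = y := by rw [he]
    let d : w → ℝ := fun i => (⟪e i, (ρ - σ) (e i)⟫_ℂ).re
    have hd : HasSum d 0 := by
      have := (hρ.hasSum_re_inner e).sub (hσ.hasSum_re_inner e)
      simpa [d, inner_sub_right] using this
    have habs : Summable fun i => |d i| := hd.summable.abs
    have hle : ∑' i, |d i| ≤ 2 * ε := by
      have h1 := (tsum_enorm_inner_orthonormal_le_trNorm e.orthonormal (ρ - σ)).trans h
      rw [← ENNReal.ofReal_le_ofReal_iff (by positivity),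
        ENNReal.ofReal_tsum_of_nonneg (fun _ => abs_nonneg _) habs]
      refine (ENNReal.tsum_le_tsum fun i => ?_).trans h1
      rw [← enorm_eq_nnnorm, ← ofReal_norm]
      exact ENNReal.ofReal_le_ofReal (Complex.abs_re_le_norm _)
    have hadd := hd.add habs.hasSum
    have hk' := le_hasSum hadd k fun i _ => by linarith [neg_abs_le (d i)]
    have hdk : d k = (⟪y, ρ y⟫_ℂ).re - (⟪y, σ y⟫_ℂ).re := by
      simp [d, hk]
    linarith [le_abs_self (d k)]
  rcases eq_or_ne x 0 with rfl | hx
  · simp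
  have hx' : ‖x‖ ≠ 0 := norm_ne_zero_iff.2 hx
  have hu := unit ((‖x‖⁻¹ : ℂ) • x) (by simp [norm_smul, hx'])
  simp only [map_smul, inner_smul_left, inner_smul_right, ← Complex.ofReal_inv,
    Complex.conj_ofReal, Complex.re_ofReal_mul] at hu
  have h2 := mul_le_mul_of_nonneg_left hu (sq_nonneg ‖x‖)
  field_simp at h2
  linarith

end AFW

namespace AFW

open Filter Topology

universe u

theorem eta_nonneg {x : ℝ} (h0 : 0 ≤ x) (h1 : x ≤ 1) : 0 ≤ eta x :=
  neg_nonneg.2 (mul_nonpos_of_nonneg_of_nonpos h0 (Real.log_nonpos h0 h1))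

theorem continuous_eta : Continuous eta := Real.continuous_mul_log.neg

/-- Gibbs' inequality for a finite vector dominated by a subprobability vector. -/
theorem sum_mul_eta_le {ι : Type*} (I : Finset ι) {t m : ι → ℝ} (ht : ∀ i ∈ I, 0 < t i)
    (htm : ∀ i ∈ I, t i ≤ m i) (hm : ∑ i ∈ I, m i ≤ 1) :
    (∑ i ∈ I, t i) * ∑ i ∈ I, eta ((∑ k ∈ I, t k)⁻¹ * t i) ≤ ∑ i ∈ I, eta (m i) := by
  rcases I.eq_empty_or_nonempty with rfl | hI
  · simp
  set S := ∑ k ∈ I, t k with hS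
  have hSpos : 0 < S := Finset.sum_pos ht hI
  have hm0 : ∀ i ∈ I, 0 ≤ m i := fun i hi => (ht i hi).le.trans (htm i hi)
  have hm1 : ∀ i ∈ I, m i ≤ 1 := fun i hi => (Finset.single_le_sum hm0 hi).trans hm
  have key : ∀ i ∈ I, S * eta (S⁻¹ * t i) ≤ eta (m i) + (S * m i - t i) := by
    intro i hi
    have hti := ht i hi
    have hmi := hti.trans_le (htm i hi)
    have hlog := Real.log_le_sub_one_of_pos (x := S * m i / t i) (by positivity)
    rw [Real.log_div (by positivity) hti.ne', Real.log_mul hSpos.ne' hmi.ne'] at hlog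
    have hlog' := mul_le_mul_of_nonneg_left hlog hti.le
    have hmul : t i * (S * m i / t i - 1) = S * m i - t i := by
      field_simp
    have hdom : 0 ≤ (m i - t i) * (-Real.log (m i)) :=
      mul_nonneg (sub_nonneg.2 (htm i hi)) (neg_nonneg.2 (Real.log_nonpos hmi.le (hm1 i hi)))
    have hl : S * eta (S⁻¹ * t i) = t i * Real.log S - t i * Real.log (t i) := by
      rw [eta, Real.log_mul (inv_ne_zero hSpos.ne') hti.ne', Real.log_inv]
      field_simp
      ring
    rw [hl, eta]
    linarith
  calc S * ∑ i ∈ I, eta (S⁻¹ * t i) ≤ ∑ i ∈ I, (eta (m i) + (S * m i - t i)) := by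
        rw [Finset.mul_sum]
        exact Finset.sum_le_sum key
    _ = ∑ i ∈ I, eta (m i) + S * (∑ i ∈ I, m i - 1) := by
        rw [Finset.sum_add_distrib, Finset.sum_sub_distrib, ← Finset.mul_sum, ← hS]
        ring
    _ ≤ ∑ i ∈ I, eta (m i) := by
        linarith [mul_nonneg hSpos.le (sub_nonneg.2 hm)]

/-- Dominated convergence from below for `ℝ≥0∞`-valued sums. -/
theorem tendsto_tsum_of_le {α ι : Type*} {l : Filter α} {g : α → ι → ℝ≥0∞} {h : ι → ℝ≥0∞}
    (hg : ∀ i, Tendsto (fun a => g a i) l (𝓝 (h i)))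
    (hle : ∀ᶠ a in l, ∑' i, g a i ≤ ∑' i, h i) :
    Tendsto (fun a => ∑' i, g a i) l (𝓝 (∑' i, h i)) := by
  refine tendsto_order.2 ⟨fun r hr => ?_, fun r hr => hle.mono fun a ha => ha.trans_lt hr⟩
  rw [ENNReal.tsum_eq_iSup_sum, lt_iSup_iff] at hr
  obtain ⟨F, hF⟩ := hr
  filter_upwards [(tendsto_finsetSum F fun i _ => hg i).eventually (lt_mem_nhds hF)] with a ha
  exact ha.trans_le (ENNReal.sum_le_tsum F)

variable {ι κ : Type*} {𝓗 : Type u} [NormedAddCommGroup 𝓗] [InnerProductSpace ℂ 𝓗]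
  [CompleteSpace 𝓗]

/-- A form of Weyl's monotonicity principle for eigenvalue counting. -/
theorem card_le_card_of_form_le {b : HilbertBasis ι ℂ 𝓗} {e : HilbertBasis κ ℂ 𝓗}
    {ρ σ : 𝓗 →L[ℂ] 𝓗} {c : ι → ℝ} {μ : κ → ℝ} {ε s : ℝ}
    (hρ : IsSelfAdjoint ρ) (hσ : IsSelfAdjoint σ)
    (hb : ∀ i, ρ (b i) = (c i : ℂ) • b i) (he : ∀ k, σ (e k) = (μ k : ℂ) • e k)
    (hle : ∀ x, (⟪x, ρ x⟫_ℂ).re ≤ (⟪x, σ x⟫_ℂ).re + ε * ‖x‖ ^ 2)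
    {A : Finset ι} {N : Finset κ} (hA : ∀ i ∈ A, s + ε ≤ c i) (hN : ∀ k, k ∉ N → μ k < s) :
    A.card ≤ N.card := by
  by_contra! hcard
  let L : (A → ℂ) →ₗ[ℂ] (N → ℂ) := LinearMap.pi fun k : N =>
    (innerSL ℂ (e k)).toLinearMap ∘ₗ Fintype.linearCombination ℂ fun i : A => b i
  have hker : L.ker ≠ ⊥ := LinearMap.ker_ne_bot_of_finrank_lt (by simpa using hcard)
  obtain ⟨a, haL, ha0⟩ := Submodule.exists_mem_ne_zero_of_ne_bot hker
  set x := Fintype.linearCombination ℂ (fun i : A => b i) a with hx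
  have hindep : LinearIndependent ℂ fun i : A => b i :=
    b.orthonormal.linearIndependent.comp _ Subtype.val_injective
  have hx0 : x ≠ 0 := fun h => ha0 (hindep.fintypeLinearCombination_injective (by simpa using h))
  have hxN : ∀ k ∈ N, ⟪e k, x⟫_ℂ = 0 := fun k hk =>
    congr_fun (LinearMap.mem_ker.1 haL) (⟨k, hk⟩ : N)
  have hxA : ∀ i, i ∉ A → ⟪b i, x⟫_ℂ = 0 := by
    intro i hi
    rw [hx, Fintype.linearCombination_apply, inner_sum]
    refine Finset.sum_eq_zero fun k _ => ?_
    rw [inner_smul_right, b.orthonormal.2 (fun h : i = k => hi (h ▸ k.2)), mul_zero]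
  have hlow : (s + ε) * ‖x‖ ^ 2 ≤ (⟪x, ρ x⟫_ℂ).re := by
    refine hasSum_le (fun i => ?_) ((hasSum_norm_sq_inner b x).mul_left (s + ε))
      (hasSum_re_inner_eigenbasis b hρ hb x)
    by_cases hi : i ∈ A
    · exact mul_le_mul_of_nonneg_right (hA i hi) (sq_nonneg _)
    · simp [hxA i hi]
  obtain ⟨k, hk⟩ : ∃ k, ⟪e k, x⟫_ℂ ≠ 0 := by
    by_contra! h
    have := hasSum_norm_sq_inner e x
    simp only [h, norm_zero, ne_eq, OfNat.ofNat_ne_zero, not_false_eq_true, zero_pow] at this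
    exact hx0 (by simpa using this.unique hasSum_zero)
  have hup : (⟪x, σ x⟫_ℂ).re < s * ‖x‖ ^ 2 := by
    refine hasSum_lt (i := k) (fun j => ?_) ?_ (hasSum_re_inner_eigenbasis e hσ he x)
      ((hasSum_norm_sq_inner e x).mul_left s)
    · by_cases hj : j ∈ N
      · simp [hxN j hj]
      · exact mul_le_mul_of_nonneg_right (hN j hj).le (sq_nonneg _)
    · exact mul_lt_mul_of_pos_right (hN k fun h => hk (hxN k h)) (by positivity)
  linarith [hle x]

open Classical in
/-- Eigenvalues of `ρ` above `ε` inject into eigenvalues of `σ`, losing at most `ε`. -/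
theorem exists_injective_eigenvalue_le {b : HilbertBasis ι ℂ 𝓗} {e : HilbertBasis κ ℂ 𝓗}
    {ρ σ : 𝓗 →L[ℂ] 𝓗} {c : ι → ℝ} {μ : κ → ℝ} {ε : ℝ}
    (hρ : IsSelfAdjoint ρ) (hσ : IsSelfAdjoint σ)
    (hb : ∀ i, ρ (b i) = (c i : ℂ) • b i) (he : ∀ k, σ (e k) = (μ k : ℂ) • e k)
    (hμ : Summable μ)
    (hle : ∀ x, (⟪x, ρ x⟫_ℂ).re ≤ (⟪x, σ x⟫_ℂ).re + ε * ‖x‖ ^ 2)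
    {I : Finset ι} (hI : ∀ i ∈ I, ε < c i) :
    ∃ f : I → κ, Function.Injective f ∧ ∀ i : I, c i - ε ≤ μ (f i) := by
  have hfin (i : I) : {k | c i - ε ≤ μ k}.Finite := by
    have := hμ.tendsto_cofinite_zero.eventually (gt_mem_nhds (sub_pos.2 (hI i i.2)))
    simpa [Filter.Eventually, Filter.mem_cofinite, Set.compl_def] using! this
  obtain ⟨f, hf, hfm⟩ := (Finset.all_card_le_biUnion_card_iff_exists_injective
    fun i : I => (hfin i).toFinset).1 fun A => by
      rcases A.eq_empty_or_nonempty with rfl | hA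
      · simp
      obtain ⟨i₀, hi₀, hmin⟩ := A.exists_min_image (fun i => c i) hA
      have hcard := card_le_card_of_form_le (s := c i₀ - ε) hρ hσ hb he hle
        (A := A.map (Function.Embedding.subtype _)) (N := (hfin i₀).toFinset)
        (fun i hi => by
          obtain ⟨j, hj, rfl⟩ := Finset.mem_map.1 hi
          simpa using hmin j hj)
        (fun k hk => by
          rw [Set.Finite.mem_toFinset] at hk
          exact not_le.1 hk)
      rw [Finset.card_map] at hcard
      exact hcard.trans (Finset.card_le_card
        (Finset.subset_biUnion_of_mem (fun i : I => (hfin i).toFinset) hi₀))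
  exact ⟨f, hf, fun i => (hfin i).mem_toFinset.1 (hfm i)⟩

/-- A state has an orthonormal eigenbasis whose eigenvalues form a probability vector. -/
theorem IsState.exists_eigenbasis {ρ : 𝓗 →L[ℂ] 𝓗} (hρ : IsState ρ) :
    ∃ (κ : Type u) (b : HilbertBasis κ ℂ 𝓗) (c : κ → ℝ),
      (∀ i, 0 ≤ c i) ∧ HasSum c 1 ∧ ∀ i, ρ (b i) = (c i : ℂ) • b i := by
  obtain ⟨κ, b, c, hc⟩ := AFW.exists_eigenbasis hρ.1 (hρ.2 ▸ ENNReal.one_ne_top)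
  refine ⟨κ, b, c, fun i => (hc i).1, ?_, fun i => (hc i).2⟩
  convert hρ.hasSum_re_inner b using 2 with i
  rw [(hc i).2, inner_smul_right, inner_self_eq_norm_sq_to_K, b.orthonormal.1 i]
  simp

theorem entropy_eq_tsum (b : HilbertBasis ι ℂ 𝓗) {T : 𝓗 →L[ℂ] 𝓗} {c : ι → ℝ}
    (hc0 : ∀ i, 0 ≤ c i) (hc1 : ∀ i, c i ≤ 1) (hT : IsSelfAdjoint T)
    (hb : ∀ i, T (b i) = (c i : ℂ) • b i) :
    entropy T = ∑' i, ENNReal.ofReal (eta (c i)) :=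
  trNorm_eq_tsum b (fun i => eta_nonneg (hc0 i) (hc1 i)) (cfc_predicate eta T)
    fun i => cfc_apply_eigenvector hT continuous_eta (hb i)

/-- The homogeneous entropy of `[ρ − εI]₊` in terms of the eigenvalues of `ρ`. -/
theorem entExt_cutAbove_eq (b : HilbertBasis ι ℂ 𝓗) {ρ : 𝓗 →L[ℂ] 𝓗} {c : ι → ℝ}
    (hρ : IsSelfAdjoint ρ) (hb : ∀ i, ρ (b i) = (c i : ℂ) • b i) {ε : ℝ} {t : ℝ}
    (ht : HasSum (fun i => max (c i - ε) 0) t) :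
    entExt (cutAbove ρ ε) =
      ENNReal.ofReal t * ∑' i, ENNReal.ofReal (eta (t⁻¹ * max (c i - ε) 0)) := by
  have hnn : ∀ i, 0 ≤ max (c i - ε) 0 := fun i => le_max_right _ _
  have ht0 : 0 ≤ t := ht.nonneg hnn
  have hsa : IsSelfAdjoint (cutAbove ρ ε) := cfc_predicate _ ρ
  have heig : ∀ i, cutAbove ρ ε (b i) = ((max (c i - ε) 0 : ℝ) : ℂ) • b i := fun i =>
    cfc_apply_eigenvector hρ (by fun_prop) (hb i)
  have htr : trNorm (cutAbove ρ ε) = ENNReal.ofReal t := by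
    rw [trNorm_eq_tsum b hnn hsa heig, ← ht.tsum_eq,
      ENNReal.ofReal_tsum_of_nonneg hnn ht.summable]
  rw [entExt, htr, ENNReal.toReal_ofReal ht0]
  by_cases h0 : cutAbove ρ ε = 0
  · rw [if_pos h0, ← htr, h0, trNorm_zero, zero_mul]
  · rw [if_neg h0, entropy_eq_tsum b (T := t⁻¹ • cutAbove ρ ε)
      (c := fun i => t⁻¹ * max (c i - ε) 0)
      (fun i => mul_nonneg (inv_nonneg.2 ht0) (hnn i)) (fun i => ?_)
      ((IsSelfAdjoint.all t⁻¹).smul hsa) (fun i => ?_)]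
    · rw [inv_mul_eq_div]
      exact div_le_one_of_le₀ (le_hasSum ht i fun k _ => hnn k) ht0
    · rw [_root_.smul_apply, heig, Complex.ofReal_mul, mul_smul, Complex.coe_smul, Complex.coe_smul]

theorem summable_max_sub {c : ι → ℝ} (hc0 : ∀ i, 0 ≤ c i) (hc : Summable c) {ε : ℝ}
    (hε : 0 ≤ ε) : Summable fun i => max (c i - ε) 0 :=
  hc.of_nonneg_of_le (fun _ => le_max_right _ _) fun i =>
    max_le (sub_le_self _ hε) (hc0 i)

/-- If `σ ≥ ρ − εI` then the entropy of `σ` dominates the homogeneous entropy of `[ρ − εI]₊`. -/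
theorem entExt_cutAbove_le {ρ σ : 𝓗 →L[ℂ] 𝓗} (hρ : IsState ρ) (hσ : IsState σ) {ε : ℝ}
    (hε : 0 < ε) (hle : ∀ x, (⟪x, ρ x⟫_ℂ).re ≤ (⟪x, σ x⟫_ℂ).re + ε * ‖x‖ ^ 2) :
    entExt (cutAbove ρ ε) ≤ entropy σ := by
  obtain ⟨ι, b, c, hc0, hc, hb⟩ := hρ.exists_eigenbasis
  obtain ⟨κ, e, μ, hμ0, hμ, he⟩ := hσ.exists_eigenbasis
  have hμ1 : ∀ k, μ k ≤ 1 := fun k => le_hasSum hμ k fun j _ => hμ0 j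
  have hfin : {i | ε < c i}.Finite := by
    have := hc.summable.tendsto_cofinite_zero.eventually (ge_mem_nhds hε)
    simpa [Filter.Eventually, Filter.mem_cofinite, Set.compl_def] using! this
  set I := hfin.toFinset with hI
  have hmem : ∀ i, i ∈ I ↔ ε < c i := fun i => hfin.mem_toFinset
  have hout : ∀ i, i ∉ I → max (c i - ε) 0 = 0 := fun i hi =>
    max_eq_right (sub_nonpos.2 (not_lt.1 (mt (hmem i).2 hi)))
  have hin : ∀ i ∈ I, max (c i - ε) 0 = c i - ε := fun i hi =>
    max_eq_left (sub_nonneg.2 ((hmem i).1 hi).le)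
  obtain ⟨f, hf, hfle⟩ := exists_injective_eigenvalue_le hρ.1.isSelfAdjoint hσ.1.isSelfAdjoint
    hb he hμ.summable hle fun i hi => (hmem i).1 hi
  have ht : HasSum (fun i => max (c i - ε) 0) (∑ i : I, (c i - ε)) := by
    rw [Finset.sum_coe_sort I fun i => c i - ε, ← Finset.sum_congr rfl hin]
    exact hasSum_sum_of_ne_finset_zero hout
  have hgibbs := sum_mul_eta_le Finset.univ (t := fun i : I => c i - ε) (m := fun i => μ (f i))
    (fun i _ => sub_pos.2 ((hmem i).1 i.2)) (fun i _ => hfle i) (by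
      simpa using sum_le_hasSum (Finset.univ.map ⟨f, hf⟩) (fun k _ => hμ0 k) hμ)
  have hS0 := ht.nonneg fun i => le_max_right (c i - ε) 0
  rw [entExt_cutAbove_eq b hρ.1.isSelfAdjoint hb ht, entropy_eq_tsum e hμ0 hμ1 hσ.1.isSelfAdjoint he]
  set S := ∑ i : I, (c i - ε) with hS
  have hη0 : ∀ i : I, 0 ≤ eta (S⁻¹ * (c i - ε)) := fun i => by
    have hi : 0 ≤ c i - ε := sub_nonneg.2 ((hmem i).1 i.2).le
    refine eta_nonneg (mul_nonneg (inv_nonneg.2 hS0) hi) ?_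
    rw [inv_mul_eq_div]
    exact div_le_one_of_le₀ (Finset.single_le_sum (f := fun i : I => c i - ε)
      (fun j _ => sub_nonneg.2 ((hmem j).1 j.2).le) (Finset.mem_univ i)) hS0
  calc ENNReal.ofReal S * ∑' i, ENNReal.ofReal (eta (S⁻¹ * max (c i - ε) 0))
      = ENNReal.ofReal (S * ∑ i : I, eta (S⁻¹ * (c i - ε))) := by
        rw [ENNReal.ofReal_mul hS0, ENNReal.ofReal_sum_of_nonneg fun i _ => hη0 i,
          tsum_eq_sum (s := I) fun i hi => by simp [hout i hi, eta],
          Finset.sum_coe_sort I fun i => ENNReal.ofReal (eta (S⁻¹ * (c i - ε)))]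
        congr 1
        exact Finset.sum_congr rfl fun i hi => by rw [hin i hi]
    _ ≤ ENNReal.ofReal (∑ i : I, eta (μ (f i))) := ENNReal.ofReal_le_ofReal hgibbs
    _ = ∑' i : I, ENNReal.ofReal (eta (μ (f i))) := by
        rw [ENNReal.ofReal_sum_of_nonneg fun i _ => eta_nonneg (hμ0 _) (hμ1 _), tsum_fintype]
    _ ≤ ∑' k, ENNReal.ofReal (eta (μ k)) :=
        ENNReal.tsum_comp_le_tsum_of_injective hf _

theorem tendsto_binEntUp : Tendsto binEntUp (𝓝[>] 0) (𝓝 0) := by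
  have hcont : Continuous binEnt :=
    continuous_eta.add (continuous_eta.comp (continuous_const.sub continuous_id))
  have h0 : binEnt 0 = 0 := by simp [binEnt, eta]
  have h := (hcont.tendsto 0).mono_left (nhdsWithin_le_nhds (s := Set.Ioi 0))
  rw [h0] at h
  refine h.congr' ?_
  filter_upwards [mem_nhdsWithin_of_mem_nhds (ge_mem_nhds (show (0 : ℝ) < 1 / 2 by norm_num))]
    with x hx
  rw [binEntUp, if_pos hx]

theorem tendsto_entExt_cutAbove {ρ : 𝓗 →L[ℂ] 𝓗} (hρ : IsState ρ) :
    Tendsto (fun ε : ℝ => entExt (cutAbove ρ ε)) (𝓝[>] 0) (𝓝 (entropy ρ)) := by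
  obtain ⟨ι, b, c, hc0, hc, hb⟩ := hρ.exists_eigenbasis
  have hc1 : ∀ i, c i ≤ 1 := fun i => le_hasSum hc i fun j _ => hc0 j
  have hpos : ∀ᶠ ε : ℝ in 𝓝[>] 0, 0 < ε := self_mem_nhdsWithin
  have hcut (i : ι) : Tendsto (fun ε => max (c i - ε) 0) (𝓝[>] 0) (𝓝 (c i)) := by
    have : Continuous fun ε => max (c i - ε) 0 := by fun_prop
    have h := (this.tendsto 0).mono_left (nhdsWithin_le_nhds (s := Set.Ioi 0))
    simpa [hc0 i] using h
  let t : ℝ → ℝ := fun ε => ∑' i, max (c i - ε) 0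
  have hsum : ∀ ε, 0 < ε → HasSum (fun i => max (c i - ε) 0) (t ε) := fun ε hε =>
    (summable_max_sub hc0 hc.summable hε.le).hasSum
  have hofReal : Tendsto (fun ε => ENNReal.ofReal (t ε)) (𝓝[>] 0) (𝓝 1) := by
    have h1 : ∑' i, ENNReal.ofReal (c i) = 1 := by
      rw [← ENNReal.ofReal_tsum_of_nonneg hc0 hc.summable, hc.tsum_eq, ENNReal.ofReal_one]
    rw [← h1]
    refine (tendsto_tsum_of_le (g := fun ε i => ENNReal.ofReal (max (c i - ε) 0))
      (fun i => ENNReal.tendsto_ofReal (hcut i)) ?_).congr' ?_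
    · filter_upwards [hpos] with ε hε
      exact ENNReal.tsum_le_tsum fun i => ENNReal.ofReal_le_ofReal
        (max_le (sub_le_self _ hε.le) (hc0 i))
    · filter_upwards [hpos] with ε hε
      rw [← (hsum ε hε).tsum_eq, ENNReal.ofReal_tsum_of_nonneg (fun i => le_max_right _ _)
        (hsum ε hε).summable]
  have ht : Tendsto t (𝓝[>] 0) (𝓝 1) := by
    refine ((ENNReal.tendsto_toReal ENNReal.one_ne_top).comp hofReal).congr fun ε => ?_
    exact ENNReal.toReal_ofReal (tsum_nonneg fun i => le_max_right _ _)
  have heq : ∀ᶠ ε in 𝓝[>] 0, ∑' i, ENNReal.ofReal (t ε) *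
      ENNReal.ofReal (eta ((t ε)⁻¹ * max (c i - ε) 0)) = entExt (cutAbove ρ ε) := by
    filter_upwards [hpos] with ε hε
    rw [entExt_cutAbove_eq b hρ.1.isSelfAdjoint hb (hsum ε hε), ENNReal.tsum_mul_left]
  have hent := entropy_eq_tsum b hc0 hc1 hρ.1.isSelfAdjoint hb
  rw [hent]
  refine (tendsto_tsum_of_le (fun i => ?_) ?_).congr' heq
  · have h := (ht.inv₀ one_ne_zero).mul (hcut i)
    rw [inv_one, one_mul] at h
    have h' := ENNReal.Tendsto.mul hofReal (Or.inl one_ne_zero)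
      (ENNReal.tendsto_ofReal ((continuous_eta.tendsto _).comp h))
      (Or.inr ENNReal.one_ne_top)
    simpa using h'
  · filter_upwards [hpos, heq] with ε hε hεeq
    rw [hεeq, ← hent]
    exact entExt_cutAbove_le hρ hρ hε fun x => le_add_of_nonneg_right (by positivity)

end AFW

namespace AFW

open Filter

/-- Proposition 2: faithful universal local lower bound for the
von Neumann entropy. -/
theorem stmt14
    {𝓗 : Type*} [NormedAddCommGroup 𝓗] [InnerProductSpace ℂ 𝓗] [CompleteSpace 𝓗]
    (ρ : 𝓗 →L[ℂ] 𝓗) (hρ : IsState ρ) :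
    (∀ σ : 𝓗 →L[ℂ] 𝓗, IsState σ → ∀ ε : ℝ, 0 < ε → ε ≤ 1 →
      trNorm (ρ - σ) ≤ ENNReal.ofReal (2 * ε) →
        entExt (cutAbove ρ ε) ≤ entropy σ + ENNReal.ofReal (binEntUp ε)) ∧
    Tendsto (fun ε : ℝ => entExt (cutAbove ρ ε) - ENNReal.ofReal (binEntUp ε))
      (nhdsWithin 0 (Set.Ioi 0)) (nhds (entropy ρ)) := by
  refine ⟨fun σ hσ ε hε _ h => ?_, ?_⟩
  · exact (entExt_cutAbove_le hρ hσ hε (re_inner_le_of_trNorm_sub_le hρ hσ hε.le h)).trans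
      le_self_add
  · have h := ENNReal.Tendsto.sub (tendsto_entExt_cutAbove hρ)
      (ENNReal.tendsto_ofReal tendsto_binEntUp) (Or.inr (by simp))
    simpa using h

end AFW
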